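/- (Fixed-point perturbation across lattice layers.) Assume γ · α⁺ < 1 and ‖W a − W* a‖ ≤ ε (κ a) for all a ∈ A. If V̂ is a fixed point of the approximate operator B (B V̂ = V̂) and V* is a fixed point of the exact operator B* (B* V* = V*), then ‖V̂ − V*‖ ≤ (γ/(1 − γ · α⁺)) · max over k ∈ K of ( (1 − α⁻_k) · ε k ). -/

import Mathlib

theorem abs_sup'_sub_sup'_le {ι : Type*} {t : Finset ι} (ht : t.Nonempty) {f g : ι → ℝ} {c : ℝ}
    (h : ∀ i ∈ t, |f i - g i| ≤ c) : |t.sup' ht f - t.sup' ht g| ≤ c := by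
  have hf : t.sup' ht f ≤ t.sup' ht g + c := Finset.sup'_le ht f fun i hi => by
    linarith [(abs_le.mp (h i hi)).2, Finset.le_sup' g hi]
  have hg : t.sup' ht g ≤ t.sup' ht f + c := Finset.sup'_le ht g fun i hi => by
    linarith [(abs_le.mp (h i hi)).1, Finset.le_sup' f hi]
  rw [abs_le]
  constructor <;> linarith

theorem abs_sum_mul_le_of_sum_eq_one {ι : Type*} {t : Finset ι} {p x : ι → ℝ} {M : ℝ}
    (hp : ∀ i ∈ t, 0 ≤ p i) (hsum : ∑ i ∈ t, p i = 1) (hx : ∀ i ∈ t, |x i| ≤ M) :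
    |∑ i ∈ t, p i * x i| ≤ M :=
  calc |∑ i ∈ t, p i * x i| ≤ ∑ i ∈ t, |p i * x i| := Finset.abs_sum_le_sum_abs _ _
    _ ≤ ∑ i ∈ t, p i * M := Finset.sum_le_sum fun i hi => by
        rw [abs_mul, abs_of_nonneg (hp i hi)]
        exact mul_le_mul_of_nonneg_left (hx i hi) (hp i hi)
    _ = M := by rw [← Finset.sum_mul, hsum, one_mul]


theorem stmt8
    {S A : Type} [Fintype S] [Nonempty S] [Fintype A] [Nonempty A]
    (α : S → A → ℝ) (T F : S → A → S → ℝ) (R : S → A → ℝ) (γ : ℝ)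
    (W : A → S → ℝ)
    (hα : ∀ s a, 0 ≤ α s a ∧ α s a ≤ 1)
    (hT : ∀ s a s', 0 ≤ T s a s') (hTsum : ∀ s a, ∑ s', T s a s' = 1)
    (hF : ∀ s a s', 0 ≤ F s a s') (hFsum : ∀ s a, ∑ s', F s a s' = 1)
    (hγ : 0 ≤ γ ∧ γ ≤ 1)
    (B : (S → ℝ) → (S → ℝ))
    (hB : ∀ V s, B V s =
      Finset.univ.sup' Finset.univ_nonempty (fun a : A =>
        R s a + γ * ∑ s', (α s a * T s a s' * V s' +
          (1 - α s a) * F s a s' * W a s')))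
    (norm' : (S → ℝ) → ℝ)
    (hnorm : ∀ V, norm' V = Finset.univ.sup' Finset.univ_nonempty (fun s : S => |V s|))
    (aplus : ℝ)
    (haplus : aplus = Finset.univ.sup' Finset.univ_nonempty (fun p : S × A => α p.1 p.2))
    {K : Type} [Fintype K] [Nonempty K] [DecidableEq K]
    (κ : A → K) (hκ : Function.Surjective κ)
    (hKne : ∀ k : K, (Finset.univ.filter (fun p : S × A => κ p.2 = k)).Nonempty)
    (aplusk ainfk : K → ℝ)
    (haplusk : ∀ k, aplusk k =
      (Finset.univ.filter (fun p : S × A => κ p.2 = k)).sup' (hKne k) (fun p => α p.1 p.2))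
    (hainfk : ∀ k, ainfk k =
      (Finset.univ.filter (fun p : S × A => κ p.2 = k)).inf' (hKne k) (fun p => α p.1 p.2))
    (Wstar : A → S → ℝ)
    (Bstar : (S → ℝ) → (S → ℝ))
    (hBstar : ∀ V s, Bstar V s =
      Finset.univ.sup' Finset.univ_nonempty (fun a : A =>
        R s a + γ * ∑ s', (α s a * T s a s' * V s' +
          (1 - α s a) * F s a s' * Wstar a s')))
    (ε : K → ℝ)
    (hlt : γ * aplus < 1)
    (herr : ∀ a : A, norm' (fun s => W a s - Wstar a s) ≤ ε (κ a))
    (Vhat : S → ℝ) (hfixhat : B Vhat = Vhat)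
    (Vstar : S → ℝ) (hfixstar : Bstar Vstar = Vstar)
    : norm' (fun s => Vhat s - Vstar s) ≤
      (γ / (1 - γ * aplus)) *
        Finset.univ.sup' Finset.univ_nonempty (fun k : K => (1 - ainfk k) * ε k) := by
  have le_norm (V : S → ℝ) (s : S) : |V s| ≤ norm' V := by
    rw [hnorm]
    exact Finset.le_sup' (fun s => |V s|) (Finset.mem_univ s)
  set D := norm' (fun s => Vhat s - Vstar s)
  set E := Finset.univ.sup' Finset.univ_nonempty (fun k : K => (1 - ainfk k) * ε k)
  have hle (s : S) (a : A) : α s a ≤ aplus := by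
    rw [haplus]
    exact Finset.le_sup' (fun p : S × A => α p.1 p.2) (Finset.mem_univ (s, a))
  have hge (s : S) (a : A) : ainfk (κ a) ≤ α s a := by
    rw [hainfk]
    exact Finset.inf'_le (fun p : S × A => α p.1 p.2) (b := (s, a)) (by simp)
  have hEge (a : A) : (1 - ainfk (κ a)) * ε (κ a) ≤ E :=
    Finset.le_sup' (fun k : K => (1 - ainfk k) * ε k) (Finset.mem_univ (κ a))
  have hstep : D ≤ γ * (aplus * D + E) := by
    refine (hnorm _).trans_le ?_
    refine Finset.sup'_le _ _ fun s _ => ?_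
    have hs : Vhat s - Vstar s = B Vhat s - Bstar Vstar s := by rw [hfixhat, hfixstar]
    rw [hs, hB, hBstar]
    refine abs_sup'_sub_sup'_le _ fun a _ => ?_
    have hdiff : (R s a + γ * ∑ s', (α s a * T s a s' * Vhat s' +
          (1 - α s a) * F s a s' * W a s')) -
        (R s a + γ * ∑ s', (α s a * T s a s' * Vstar s' +
          (1 - α s a) * F s a s' * Wstar a s')) =
        γ * (α s a * ∑ s', T s a s' * (Vhat s' - Vstar s') +
          (1 - α s a) * ∑ s', F s a s' * (W a s' - Wstar a s')) := by
      rw [add_sub_add_left_eq_sub, ← mul_sub, ← Finset.sum_sub_distrib,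
        Finset.mul_sum _ _ (α s a),
        Finset.mul_sum _ _ (1 - α s a), ← Finset.sum_add_distrib]
      congr 1
      exact Finset.sum_congr rfl fun s' _ => by ring
    rw [hdiff, abs_mul, abs_of_nonneg hγ.1]
    refine mul_le_mul_of_nonneg_left ((abs_add_le _ _).trans (add_le_add ?_ ?_)) hγ.1
    · rw [abs_mul, abs_of_nonneg (hα s a).1]
      exact mul_le_mul (hle s a)
        (abs_sum_mul_le_of_sum_eq_one (fun s' _ => hT s a s') (hTsum s a)
          fun s' _ => le_norm (fun s => Vhat s - Vstar s) s')
        (abs_nonneg _) ((hα s a).1.trans (hle s a))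
    · have h1 : 0 ≤ 1 - α s a := sub_nonneg.mpr (hα s a).2
      have h2 : 1 - α s a ≤ 1 - ainfk (κ a) := sub_le_sub_left (hge s a) 1
      rw [abs_mul, abs_of_nonneg h1]
      exact (mul_le_mul h2
        (abs_sum_mul_le_of_sum_eq_one (fun s' _ => hF s a s') (hFsum s a)
          fun s' _ => (le_norm (fun s => W a s - Wstar a s) s').trans (herr a))
        (abs_nonneg _) (h1.trans h2)).trans (hEge a)
  rw [div_mul_eq_mul_div, le_div_iff₀ (sub_pos.mpr hlt)]
  linarith
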